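/- Let q ∈ (0,1) be fixed. Then P_q(n) ∼ ∑_{k=0}^{n/p(n)} φ_q(k, n/p(n))^{p(n)} as n → ∞, i.e., the ratio P_q(n) / (∑_{k=0}^{n/p(n)} φ_q(k, n/p(n))^{p(n)}) tends to 1 as n → ∞ over integers n ≥ 2, where p(n) denotes the smallest prime divisor of n. -/

import Mathlib

open Finset

/-- The binomial probability mass function. -/
noncomputable def phi (q : ℝ) (k n : ℕ) : ℝ :=
  (n.choose k : ℝ) * q ^ k * (1 - q) ^ (n - k)

/-- The Bernoulli(q) probability weight of an outcome `c : Fin n → Bool`. -/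
noncomputable def bernWeight (q : ℝ) (n : ℕ) (c : Fin n → Bool) : ℝ :=
  q ^ (Finset.univ.filter (fun j => c j = true)).card *
    (1 - q) ^ (n - (Finset.univ.filter (fun j => c j = true)).card)

/-- Singularity probability of an `n × n` circulant Bernoulli(q) matrix (0/1 entries). -/
noncomputable def Pq (q : ℝ) (n : ℕ) : ℝ :=
  ∑ c : Fin n → Bool,
    if (Matrix.of fun i j : Fin n => (if c (j - i) then (1 : ℚ) else 0)).det = 0 then
      bernWeight q n c
    else 0

noncomputable def phiMax (q : ℝ) (m : ℕ) : ℝ :=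
  (range (m + 1)).sup' ⟨0, by simp⟩ (fun k => phi q k m)

section
variable {q : ℝ}

lemma phi_nonneg (hq0 : 0 < q) (hq1 : q < 1) (k m : ℕ) : 0 ≤ phi q k m := by
  have : 0 < 1 - q := by linarith
  unfold phi; positivity

lemma phi_eq_zero {k m : ℕ} (h : m < k) : phi q k m = 0 := by
  simp [phi, Nat.choose_eq_zero_of_lt h]

lemma phi_pos (hq0 : 0 < q) (hq1 : q < 1) {k m : ℕ} (h : k ≤ m) : 0 < phi q k m := by
  have : 0 < 1 - q := by linarith
  have := Nat.choose_pos h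
  unfold phi; positivity

lemma sum_phi (m : ℕ) : ∑ k ∈ range (m + 1), phi q k m = 1 := by
  have := add_pow q (1 - q) m
  rw [show q + (1 - q) = 1 by ring, one_pow] at this
  rw [this]
  refine sum_congr rfl fun k _ => ?_
  unfold phi; ring

lemma phiMax_exists (q : ℝ) (m : ℕ) : ∃ k ≤ m, phi q k m = phiMax q m := by
  obtain ⟨k, hk, h⟩ := exists_mem_eq_sup' (s := range (m + 1)) ⟨0, by simp⟩ (fun k => phi q k m)
  exact ⟨k, by simpa [Nat.lt_succ_iff] using hk, h.symm⟩

lemma phiMax_pos (hq0 : 0 < q) (hq1 : q < 1) (m : ℕ) : 0 < phiMax q m := by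
  obtain ⟨k, hk, h⟩ := phiMax_exists q m
  rw [← h]; exact phi_pos hq0 hq1 hk

lemma phi_le_phiMax (hq0 : 0 < q) (hq1 : q < 1) (k m : ℕ) : phi q k m ≤ phiMax q m := by
  by_cases h : k ≤ m
  · exact le_sup' (fun k => phi q k m) (by simpa [Nat.lt_succ_iff] using h)
  · rw [phi_eq_zero (by omega)]; exact (phiMax_pos hq0 hq1 m).le

lemma phi_succ_succ (k m : ℕ) :
    phi q (k + 1) (m + 1) = q * phi q k m + (1 - q) * phi q (k + 1) m := by
  unfold phi
  rw [Nat.choose_succ_succ]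
  rcases lt_trichotomy k m with h | h | h
  · rw [show m + 1 - (k + 1) = m - k by omega, show m - k = m - (k + 1) + 1 by omega]
    push_cast; ring
  · subst h
    simp; ring
  · simp [Nat.choose_eq_zero_of_lt h, Nat.choose_eq_zero_of_lt (show m < k + 1 by omega)]

lemma phi_zero_succ (m : ℕ) : phi q 0 (m + 1) = (1 - q) * phi q 0 m := by
  unfold phi; simp; ring

lemma phiMax_succ_le (hq0 : 0 < q) (hq1 : q < 1) (m : ℕ) : phiMax q (m + 1) ≤ phiMax q m := by
  obtain ⟨k, hk, h⟩ := phiMax_exists q (m + 1)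
  rw [← h]
  cases k with
  | zero =>
    rw [phi_zero_succ]
    nlinarith [phi_le_phiMax hq0 hq1 0 m, phi_nonneg hq0 hq1 0 m]
  | succ k =>
    rw [phi_succ_succ]
    nlinarith [phi_le_phiMax hq0 hq1 k m, phi_le_phiMax hq0 hq1 (k + 1) m]

lemma phiMax_antitone (hq0 : 0 < q) (hq1 : q < 1) : Antitone (phiMax q) :=
  antitone_nat_of_succ_le (phiMax_succ_le hq0 hq1)

lemma phiMax_le_one (hq0 : 0 < q) (hq1 : q < 1) {m : ℕ} (hm : 1 ≤ m) :
    phiMax q m ≤ max q (1 - q) := by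
  refine (phiMax_antitone hq0 hq1 hm).trans ?_
  obtain ⟨k, hk, h⟩ := phiMax_exists q 1
  rw [← h]
  interval_cases k <;> simp [phi]

-- the two ratio identities
lemma phi_ratio_a (k m : ℕ) (hk : k ≤ m) :
    phi q k (m + 1) * ((m : ℝ) + 1 - k) = phi q k m * ((m + 1) * (1 - q)) := by
  unfold phi
  have h := Nat.choose_mul_succ_eq m k
  have h' : ((m.choose k : ℝ)) * (m + 1) = ((m+1).choose k : ℝ) * ((m : ℝ) + 1 - k) := by
    have : ((m.choose k * (m + 1) : ℕ) : ℝ) = (((m + 1).choose k * (m + 1 - k) : ℕ) : ℝ) := by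
      rw [h]
    rw [Nat.cast_mul, Nat.cast_mul, Nat.cast_sub (by omega)] at this
    push_cast at this; exact this
  rw [show m + 1 - k = m - k + 1 by omega, pow_succ]
  linear_combination (-(q ^ k * ((1 - q) ^ (m - k) * (1 - q)))) * h'

lemma phi_ratio_b (k m : ℕ) :
    phi q (k + 1) (m + 1) * ((k : ℝ) + 1) = phi q k m * ((m + 1) * q) := by
  unfold phi
  have h := Nat.add_one_mul_choose_eq m k
  have h' : ((m : ℝ) + 1) * (m.choose k) = ((m+1).choose (k+1) : ℝ) * (k + 1) := by
    exact_mod_cast h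
  rw [show m + 1 - (k + 1) = m - k by omega, pow_succ]
  linear_combination (-(q ^ k * q * ((1 - q) ^ (m - k)))) * h'

lemma phi_ratio_c (k m : ℕ) (hk : k ≤ m) :
    phi q (k + 1) m * ((k + 1) * (1 - q)) = phi q k m * (((m : ℝ) - k) * q) := by
  unfold phi
  have h := Nat.choose_succ_right_eq m k
  have h' : ((m.choose (k+1) : ℝ)) * (k + 1) = (m.choose k : ℝ) * ((m : ℝ) - k) := by
    have : ((m.choose (k+1) * (k + 1) : ℕ) : ℝ) = ((m.choose k * (m - k) : ℕ) : ℝ) := by rw [h]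
    rw [Nat.cast_mul, Nat.cast_mul, Nat.cast_sub hk] at this
    push_cast at this; exact this
  rcases hk.lt_or_eq with hlt | rfl
  · rw [show m - k = m - (k + 1) + 1 by omega, pow_succ, pow_succ]
    linear_combination (q ^ k * q * ((1 - q) ^ (m - (k + 1)) * (1 - q))) * h'
  · simp

lemma phiMax_mono_succ (hq0 : 0 < q) (hq1 : q < 1) (m : ℕ) :
    ((m : ℝ) + 1) * phiMax q m ≤ ((m + 1 : ℕ) + 1) * phiMax q (m + 1) := by
  obtain ⟨k, hk, h⟩ := phiMax_exists q m
  have ha := phi_ratio_a (q := q) k m hk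
  have hb := phi_ratio_b (q := q) k m
  have h1 := phi_le_phiMax hq0 hq1 k (m + 1)
  have h2 := phi_le_phiMax hq0 hq1 (k + 1) (m + 1)
  rw [h] at ha hb
  have hk' : (k : ℝ) ≤ m := by exact_mod_cast hk
  have e1 : phi q k (m + 1) * ((m : ℝ) + 1 - k) ≤ phiMax q (m+1) * ((m : ℝ) + 1 - k) :=
    mul_le_mul_of_nonneg_right h1 (by linarith)
  have e2 : phi q (k + 1) (m + 1) * ((k : ℝ) + 1) ≤ phiMax q (m+1) * ((k : ℝ) + 1) :=
    mul_le_mul_of_nonneg_right h2 (by positivity)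
  push_cast
  nlinarith

lemma phiMax_mono (hq0 : 0 < q) (hq1 : q < 1) :
    Monotone (fun m : ℕ => ((m : ℝ) + 1) * phiMax q m) :=
  monotone_nat_of_le_succ (phiMax_mono_succ hq0 hq1)

lemma phiMax_ge (hq0 : 0 < q) (hq1 : q < 1) (m : ℕ) : 1 / ((m : ℝ) + 1) ≤ phiMax q m := by
  have := phiMax_mono hq0 hq1 (Nat.zero_le m)
  have h0 : 1 ≤ phiMax q 0 := by
    have := phi_le_phiMax hq0 hq1 0 0
    simpa [phi] using this
  simp only [] at this
  rw [div_le_iff₀ (by positivity)]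
  push_cast at this
  linarith

lemma phiMax_comp (hq0 : 0 < q) (hq1 : q < 1) {n d p : ℕ} (hn : 0 < n) (hd : d ∣ n) (hp : p ∣ n)
    (hpd : p ≤ d) : phiMax q (n / d) ≤ (d : ℝ) / p * phiMax q (n / p) := by
  obtain ⟨a, rfl⟩ := hd
  obtain ⟨b, hb⟩ := hp
  have hd0 : 0 < d := Nat.pos_of_ne_zero (by rintro rfl; simp at hn)
  have hp0 : 0 < p := Nat.pos_of_ne_zero (by rintro rfl; rw [zero_mul] at hb; omega)
  have e1 : d * a / d = a := Nat.mul_div_cancel_left _ hd0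
  have e2 : d * a / p = b := by rw [hb]; exact Nat.mul_div_cancel_left _ hp0
  rw [e1, e2]
  have hab : a ≤ b := by
    by_contra hlt
    push Not at hlt
    have : p * b < d * a := by nlinarith
    omega
  have hm := phiMax_mono hq0 hq1 hab
  simp only [] at hm
  have hp0' : (0 : ℝ) < p := by exact_mod_cast hp0
  have hb' : (d : ℝ) * a = p * b := by exact_mod_cast hb
  have hpd' : (p : ℝ) ≤ d := by exact_mod_cast hpd
  have hM := phiMax_pos hq0 hq1 b
  rw [div_mul_eq_mul_div, le_div_iff₀ hp0']
  have ha0 : (0 : ℝ) < (a : ℝ) + 1 := by positivity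
  have : phiMax q a * p * (a + 1) ≤ d * phiMax q b * (a + 1) := by
    calc phiMax q a * p * (a + 1) = p * (((a : ℝ) + 1) * phiMax q a) := by ring
      _ ≤ p * (((b : ℝ) + 1) * phiMax q b) := by gcongr
      _ = (p * b + p) * phiMax q b := by ring
      _ ≤ (d * a + d) * phiMax q b := by rw [hb']; gcongr
      _ = _ := by ring
  exact le_of_mul_le_mul_right this ha0

lemma sum_sq_ge (hq0 : 0 < q) (hq1 : q < 1) (K : ℕ) (hK : 0 < K) :
    ∃ m0 : ℕ, ∀ m ≥ m0, (K : ℝ) * phiMax q m ^ 2 ≤ ∑ k ∈ range (m + 1), phi q k m ^ 2 := by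
  set J := 4 * K with hJ
  set ε : ℝ := 1 / (2 * J) with hε
  have hJ0 : (0 : ℝ) < J := by
    have : 0 < J := by omega
    exact_mod_cast this
  have hε0 : 0 < ε := by positivity
  have hq1' : 0 < 1 - q := by linarith
  obtain ⟨m0, hm0⟩ := exists_nat_ge ((1 + J) / (ε * q * (1 - q)))
  refine ⟨m0, fun m hm => ?_⟩
  have hm' : (1 + J : ℝ) ≤ ε * (m + 1) * q * (1 - q) := by
    have h1 : (1 + J : ℝ) / (ε * q * (1 - q)) ≤ m + 1 := by
      have : (m0 : ℝ) ≤ m := by exact_mod_cast hm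
      linarith
    rw [div_le_iff₀ (by positivity)] at h1
    linarith
  obtain ⟨k, hk, h⟩ := phiMax_exists q m
  have hM := phiMax_pos hq0 hq1 m
  have hε1 : ε ≤ 1 / 2 := by
    rw [hε]
    apply one_div_le_one_div_of_le (by norm_num)
    have : (1 : ℝ) ≤ J := by exact_mod_cast (show 1 ≤ J by omega)
    linarith
  -- k ≤ (m+1) q
  have hkq : (k : ℝ) ≤ (m + 1) * q := by
    cases k with
    | zero => simp; positivity
    | succ k =>
      have hr := phi_ratio_c (q := q) k m (by omega)
      have hle := phi_le_phiMax hq0 hq1 k m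
      rw [← h] at hle
      have hpos := phi_pos hq0 hq1 hk
      have hkm : (k : ℝ) + 1 ≤ m := by exact_mod_cast hk
      have : phi q (k+1) m * ((k + 1) * (1 - q)) ≤ phi q (k+1) m * (((m : ℝ) - k) * q) := by
        rw [hr]
        apply mul_le_mul_of_nonneg_right hle
        apply mul_nonneg _ hq0.le
        linarith
      have := le_of_mul_le_mul_left this hpos
      push_cast
      linarith
  have key : ∀ j : ℕ, j ≤ J → k + j ≤ m ∧ (1 - ε) ^ j * phiMax q m ≤ phi q (k + j) m := by
    intro j
    induction j with
    | zero => intro _; simp [h, hk]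
    | succ j ih =>
      intro hj
      obtain ⟨h1, h2⟩ := ih (by omega)
      have hr := phi_ratio_c (q := q) (k + j) m h1
      have hjJ : (j : ℝ) + 1 ≤ J := by exact_mod_cast hj
      have hratio : (1 - ε) * (((k + j : ℕ) + 1 : ℝ) * (1 - q)) ≤ ((m : ℝ) - (k + j : ℕ)) * q := by
        push_cast
        have t1 : (1 - ε) * (1 - q) * k ≤ (1 - ε) * (1 - q) * ((m + 1) * q) := by
          apply mul_le_mul_of_nonneg_left hkq
          apply mul_nonneg <;> linarith
        have t2 : q * (m - k - j) ≥ q * (m - (m + 1) * q - j) := by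
          apply mul_le_mul_of_nonneg_left _ hq0.le; linarith
        have t3 : (1 - ε) * (1 - q) * (j + 1) ≤ 1 * (1 - q) * (j + 1) := by
          gcongr; linarith
        nlinarith
      have hkjm : k + j < m := by
        rcases h1.lt_or_eq with h3 | h3
        · exact h3
        · exfalso
          rw [← h3] at hratio
          have : 0 < (1 - ε) * (((k + j : ℕ) + 1 : ℝ) * (1 - q)) := by
            apply mul_pos (by linarith); positivity
          simp at hratio
          push_cast at this
          linarith
      refine ⟨by omega, ?_⟩
      have hD : (0 : ℝ) < ((k + j : ℕ) + 1 : ℝ) * (1 - q) := by positivity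
      have : (1 - ε) ^ (j + 1) * phiMax q m * (((k + j : ℕ) + 1 : ℝ) * (1 - q)) ≤
          phi q (k + j + 1) m * (((k + j : ℕ) + 1 : ℝ) * (1 - q)) := by
        rw [hr]
        calc _ = ((1 - ε) ^ j * phiMax q m) * ((1 - ε) * (((k + j : ℕ) + 1 : ℝ) * (1 - q))) := by
              ring
          _ ≤ phi q (k + j) m * ((1 - ε) * (((k + j : ℕ) + 1 : ℝ) * (1 - q))) := by
              apply mul_le_mul_of_nonneg_right h2
              apply mul_nonneg _ hD.le; linarith
          _ ≤ _ := by
              apply mul_le_mul_of_nonneg_left hratio (phi_nonneg hq0 hq1 _ _)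
      exact le_of_mul_le_mul_right this hD
  have half : ∀ j < J, phiMax q m / 2 ≤ phi q (k + j) m := by
    intro j hj
    refine le_trans ?_ (key j hj.le).2
    have hb := one_add_mul_le_pow (show (-2 : ℝ) ≤ -ε by linarith) j
    have hjJ : (j : ℝ) ≤ J := by exact_mod_cast hj.le
    have : (j : ℝ) * ε ≤ 1 / 2 := by
      calc (j : ℝ) * ε ≤ J * ε := by gcongr
        _ = 1 / 2 := by rw [hε]; field_simp
    have hb2 : 1 / 2 ≤ (1 - ε) ^ j := by
      rw [sub_eq_add_neg]; linarith
    nlinarith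
  calc (K : ℝ) * phiMax q m ^ 2 = ∑ j ∈ range J, (phiMax q m / 2) ^ 2 := by
        rw [sum_const, card_range, hJ, nsmul_eq_mul]; push_cast; ring
    _ ≤ ∑ j ∈ range J, phi q (k + j) m ^ 2 := by
        apply sum_le_sum
        intro j hj
        have := half j (by simpa using hj)
        gcongr
    _ = ∑ i ∈ (range J).image (fun j => k + j), phi q i m ^ 2 := by
        rw [sum_image]; intro a _ b _ hab; simpa using hab
    _ ≤ _ := by
        apply sum_le_sum_of_subset_of_nonneg
        · intro i hi
          simp only [mem_image, mem_range] at hi ⊢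
          obtain ⟨j, hj, rfl⟩ := hi
          have := (key j hj.le).1
          omega
        · intros; positivity

lemma phiMax_small (hq0 : 0 < q) (hq1 : q < 1) {δ : ℝ} (hδ : 0 < δ) :
    ∃ m0 : ℕ, ∀ m ≥ m0, phiMax q m ≤ δ := by
  obtain ⟨K, hK⟩ := exists_nat_gt (1 / δ)
  have hK0' : (0 : ℝ) < K := lt_trans (by positivity) hK
  have hK0 : 0 < K := by exact_mod_cast hK0'
  obtain ⟨m0, hm0⟩ := sum_sq_ge hq0 hq1 K hK0
  refine ⟨m0, fun m hm => ?_⟩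
  have h1 := hm0 m hm
  have hM := phiMax_pos hq0 hq1 m
  have h2 : ∑ k ∈ range (m + 1), phi q k m ^ 2 ≤ phiMax q m := by
    calc _ ≤ ∑ k ∈ range (m + 1), phiMax q m * phi q k m := by
          apply sum_le_sum
          intro k _
          rw [sq]
          exact mul_le_mul_of_nonneg_right (phi_le_phiMax hq0 hq1 k m) (phi_nonneg hq0 hq1 k m)
      _ = _ := by rw [← mul_sum, sum_phi, mul_one]
  have h3 : (K : ℝ) * phiMax q m ≤ 1 := by
    by_contra hc
    push Not at hc
    nlinarith
  rw [div_lt_iff₀ hδ] at hK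
  by_contra hc
  push Not at hc
  nlinarith

end

section comb

/-- number of ones -/
def cntOnes {m : ℕ} (x : Fin m → Bool) : ℕ := (univ.filter (fun j => x j = true)).card

def clsSum {m d : ℕ} (c : Fin (m * d) → Bool) (r : Fin d) : ℕ :=
  cntOnes (fun a : Fin m => c (finProdFinEquiv (a, r)))

noncomputable def evl {n : ℕ} (c : Fin n → Bool) (ξ : ℂ) : ℂ :=
  ∑ j : Fin n, (if c j then (1 : ℂ) else 0) * ξ ^ (j : ℕ)

lemma bernWeight_eq_prod (q : ℝ) (n : ℕ) (c : Fin n → Bool) :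
    bernWeight q n c = ∏ j, (if c j then q else 1 - q) := by
  rw [Finset.prod_ite, prod_const, prod_const, bernWeight]
  congr 2
  have := Finset.card_filter_add_card_filter_not (s := (univ : Finset (Fin n))) (fun j => c j = true)
  rw [card_univ, Fintype.card_fin] at this
  omega

lemma bernWeight_nonneg {q : ℝ} (hq0 : 0 < q) (hq1 : q < 1) (n : ℕ) (c : Fin n → Bool) :
    0 ≤ bernWeight q n c := by
  have : 0 < 1 - q := by linarith
  unfold bernWeight; positivity

lemma cntOnes_le {m : ℕ} (x : Fin m → Bool) : cntOnes x ≤ m := by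
  have := card_le_univ (univ.filter (fun j => x j = true))
  simpa [cntOnes] using this

lemma card_cntOnes (m k : ℕ) :
    (univ.filter (fun x : Fin m → Bool => cntOnes x = k)).card = m.choose k := by
  have := Finset.card_powersetCard k (univ : Finset (Fin m))
  rw [card_univ, Fintype.card_fin] at this
  rw [← this]
  refine card_nbij' (fun x => univ.filter (fun j => x j = true)) (fun s j => decide (j ∈ s)) ?_ ?_ ?_ ?_
  · intro x hx
    have hx' := (mem_filter.1 hx).2
    exact mem_powersetCard.2 ⟨subset_univ _, hx'⟩
  · intro s hs
    have hs' := (mem_powersetCard.1 hs).2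
    refine mem_filter.2 ⟨mem_univ _, ?_⟩
    simpa [cntOnes] using hs'
  · intro x _
    ext j; simp
  · intro s _
    ext j; simp

lemma sum_cntOnes (q : ℝ) (m k : ℕ) :
    ∑ x ∈ univ.filter (fun x : Fin m → Bool => cntOnes x = k), bernWeight q m x = phi q k m := by
  have : ∀ x ∈ univ.filter (fun x : Fin m → Bool => cntOnes x = k),
      bernWeight q m x = q ^ k * (1 - q) ^ (m - k) := by
    intro x hx
    have hx : cntOnes x = k := by simpa using hx
    unfold bernWeight
    unfold cntOnes at hx
    rw [hx]
  rw [sum_congr rfl this, sum_const, card_cntOnes, nsmul_eq_mul, phi]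
  ring

def rowsEquiv (m d : ℕ) : (Fin (m * d) → Bool) ≃ (Fin d → Fin m → Bool) where
  toFun c r a := c (finProdFinEquiv (a, r))
  invFun R j := R (finProdFinEquiv.symm j).2 (finProdFinEquiv.symm j).1
  left_inv c := by ext j; exact congrArg c (finProdFinEquiv.apply_symm_apply j)
  right_inv R := by ext r a; simp

lemma sum_cls (q : ℝ) (m d : ℕ) (G : (Fin d → ℕ) → ℝ) :
    ∑ c : Fin (m * d) → Bool, G (clsSum c) * bernWeight q (m * d) c =
      ∑ s ∈ Fintype.piFinset (fun _ : Fin d => range (m + 1)), G s * ∏ r, phi q (s r) m := by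
  have h1 : ∑ c : Fin (m * d) → Bool, G (clsSum c) * bernWeight q (m * d) c =
      ∑ R : Fin d → Fin m → Bool, G (fun r => cntOnes (R r)) * ∏ r, bernWeight q m (R r) := by
    rw [← Equiv.sum_comp (rowsEquiv m d)]
    refine sum_congr rfl fun c _ => ?_
    congr 1
    rw [bernWeight_eq_prod, ← Equiv.prod_comp finProdFinEquiv, Fintype.prod_prod_type_right]
    refine prod_congr rfl fun r _ => ?_
    rw [bernWeight_eq_prod]; rfl
  rw [h1, ← sum_fiberwise_of_maps_to (s := univ)
    (t := Fintype.piFinset (fun _ : Fin d => range (m + 1)))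
    (g := fun (R : Fin d → Fin m → Bool) r => cntOnes (R r))]
  · refine sum_congr rfl fun s _ => ?_
    have h2 : ∀ R ∈ univ.filter (fun R : Fin d → Fin m → Bool => (fun r => cntOnes (R r)) = s),
        G (fun r => cntOnes (R r)) * ∏ r, bernWeight q m (R r) =
        G s * ∏ r, bernWeight q m (R r) := by
      intro R hR
      rw [(mem_filter.1 hR).2]
    rw [sum_congr rfl h2, ← mul_sum]
    congr 1
    have h3 : univ.filter (fun R : Fin d → Fin m → Bool => (fun r => cntOnes (R r)) = s) =
        Fintype.piFinset (fun r => univ.filter (fun x : Fin m → Bool => cntOnes x = s r)) := by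
      ext R
      simp [Fintype.mem_piFinset, funext_iff]
    rw [h3, ← prod_univ_sum]
    exact prod_congr rfl fun r _ => sum_cntOnes q m (s r)
  · intro R _
    rw [Fintype.mem_piFinset]
    intro r
    simpa [Nat.lt_succ_iff] using cntOnes_le (R r)

lemma evl_cls {m d : ℕ} (c : Fin (m * d) → Bool) (ξ : ℂ) (hξ : ξ ^ d = 1) :
    evl c ξ = ∑ r : Fin d, (clsSum c r : ℂ) * ξ ^ (r : ℕ) := by
  unfold evl
  rw [← Equiv.sum_comp finProdFinEquiv, Fintype.sum_prod_type_right]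
  refine sum_congr rfl fun r _ => ?_
  have : ∀ a : Fin m, ξ ^ ((finProdFinEquiv (a, r) : Fin (m * d)) : ℕ) = ξ ^ (r : ℕ) := by
    intro a
    simp only [finProdFinEquiv, Equiv.coe_fn_mk]
    rw [pow_add, pow_mul, hξ, one_pow, mul_one]
  simp_rw [this]
  rw [← sum_mul]
  congr 1
  simp [clsSum, cntOnes]

lemma det_iff {n : ℕ} [NeZero n] (c : Fin n → Bool) {ζ : ℂ} (hζ : IsPrimitiveRoot ζ n) :
    (Matrix.of fun i j : Fin n => (if c (j - i) then (1 : ℚ) else 0)).det = 0 ↔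
      ∃ k : Fin n, evl c (ζ ^ (k : ℕ)) = 0 := by
  set A : Matrix (Fin n) (Fin n) ℚ := Matrix.of fun i j : Fin n => (if c (j - i) then (1 : ℚ) else 0)
  set B : Matrix (Fin n) (Fin n) ℂ := A.map (algebraMap ℚ ℂ) with hB
  set F : Matrix (Fin n) (Fin n) ℂ := (Matrix.vandermonde (fun k : Fin n => ζ ^ (k : ℕ))).transpose
    with hF
  have hdetF : F.det ≠ 0 := by
    rw [hF, Matrix.det_transpose, Matrix.det_vandermonde_ne_zero_iff]
    intro a b hab
    exact Fin.ext (hζ.pow_inj a.2 b.2 hab)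
  have hBdet : B.det = algebraMap ℚ ℂ A.det := by
    rw [hB]
    exact (RingHom.map_det (algebraMap ℚ ℂ) A).symm
  have hmul : B * F = F * Matrix.diagonal (fun k : Fin n => evl c (ζ ^ (k : ℕ))) := by
    ext i k
    rw [Matrix.mul_diagonal, Matrix.mul_apply]
    have : ∀ j, B i j * F j k = (if c (j - i) then (1 : ℂ) else 0) * (ζ ^ (k : ℕ)) ^ (j : ℕ) := by
      intro j
      simp only [hB, hF, A, Matrix.map_apply, Matrix.of_apply, Matrix.transpose_apply,
        Matrix.vandermonde_apply]
      split_ifs <;> simp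
    rw [sum_congr rfl fun j _ => this j, ← Equiv.sum_comp (Equiv.addRight i)]
    simp only [Equiv.coe_addRight, add_sub_cancel_right]
    rw [hF, Matrix.transpose_apply, Matrix.vandermonde_apply, evl, mul_sum]
    refine sum_congr rfl fun j _ => ?_
    have hper : (ζ ^ (k : ℕ)) ^ n = 1 := by rw [← pow_mul, mul_comm, pow_mul, hζ.pow_eq_one, one_pow]
    have : (ζ ^ (k : ℕ)) ^ ((j + i : Fin n) : ℕ) = (ζ ^ (k : ℕ)) ^ ((j : ℕ) + i) := by
      rw [Fin.val_add]
      conv_rhs => rw [← Nat.mod_add_div ((j : ℕ) + i) n, pow_add, pow_mul, hper, one_pow, mul_one]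
    rw [this, pow_add]; ring
  have hd := congrArg Matrix.det hmul
  rw [Matrix.det_mul, Matrix.det_mul, Matrix.det_diagonal, mul_comm] at hd
  have hd' := mul_left_cancel₀ hdetF hd
  rw [hBdet] at hd'
  have h0 : A.det = 0 ↔ algebraMap ℚ ℂ A.det = 0 := by simp
  rw [h0, hd', prod_eq_zero_iff]
  simp

noncomputable def zt (d : ℕ) : ℂ := Complex.exp (2 * Real.pi * Complex.I / d)

lemma zt_prim {d : ℕ} (hd : d ≠ 0) : IsPrimitiveRoot (zt d) d := Complex.isPrimitiveRoot_exp d hd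

/-- conjugate roots -/
lemma evl_conj {n d : ℕ} (hd : 0 < d) (c : Fin n → Bool) {ξ η : ℂ} (hξ : IsPrimitiveRoot ξ d)
    (hη : IsPrimitiveRoot η d) (h : evl c ξ = 0) : evl c η = 0 := by
  set f : Polynomial ℚ := ∑ j : Fin n, Polynomial.C (if c j then (1 : ℚ) else 0) * Polynomial.X ^ (j : ℕ)
  have hf : ∀ x : ℂ, Polynomial.aeval x f = evl c x := by
    intro x
    simp only [f, evl, map_sum, map_mul, map_pow, Polynomial.aeval_X, Polynomial.aeval_C]
    refine sum_congr rfl fun j _ => ?_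
    split_ifs <;> simp
  rw [← hf] at h ⊢
  have h1 := minpoly.dvd ℚ ξ h
  rw [← Polynomial.cyclotomic_eq_minpoly_rat hξ hd, Polynomial.cyclotomic_eq_minpoly_rat hη hd] at h1
  exact Polynomial.aeval_eq_zero_of_dvd_aeval_eq_zero h1 (minpoly.aeval ℚ η)

lemma lin_indep {d : ℕ} (hd : 0 < d) (a : Fin d → ℤ) (h : ∑ r : Fin d, (a r : ℂ) * zt d ^ (r : ℕ) = 0)
    (hz : ∀ r : Fin d, d.totient ≤ r → a r = 0) : ∀ r, a r = 0 := by
  set f : Polynomial ℚ := ∑ j : Fin d, Polynomial.C (a j : ℚ) * Polynomial.X ^ (j : ℕ) with hf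
  have hcoef : ∀ r : Fin d, f.coeff r = a r := by
    intro r
    rw [hf, Polynomial.finsetSum_coeff, sum_eq_single r]
    · simp
    · intro b _ hb
      rw [Polynomial.coeff_C_mul_X_pow, if_neg]
      intro hh; exact hb (Fin.ext hh.symm)
    · simp
  have h0 : Polynomial.aeval (zt d) f = 0 := by
    rw [← h]
    simp [f]
  have hdeg : f.degree < (Polynomial.cyclotomic d ℚ).degree := by
    rw [Polynomial.degree_cyclotomic]
    refine (Polynomial.degree_lt_iff_coeff_zero _ _).2 fun i hi => ?_
    by_cases hid : i < d
    · have := hcoef ⟨i, hid⟩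
      simp only at this
      rw [this, hz ⟨i, hid⟩ hi]; simp
    · rw [hf, Polynomial.finsetSum_coeff]
      refine sum_eq_zero fun b _ => ?_
      rw [Polynomial.coeff_C_mul_X_pow, if_neg]
      have := b.2; omega
  have h1 := minpoly.dvd ℚ (zt d) h0
  rw [← Polynomial.cyclotomic_eq_minpoly_rat (zt_prim hd.ne') hd] at h1
  have hf0 : f = 0 := Polynomial.eq_zero_of_dvd_of_degree_lt h1 hdeg
  intro r
  have := hcoef r
  rw [hf0] at this
  simpa using this.symm

noncomputable def Pd (q : ℝ) (n d : ℕ) : ℝ :=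
  ∑ c : Fin n → Bool, if evl c (zt d) = 0 then bernWeight q n c else 0

lemma Pd_eq (q : ℝ) (m d : ℕ) (hd : 0 < d) :
    Pd q (m * d) d = ∑ s ∈ (Fintype.piFinset (fun _ : Fin d => range (m + 1))).filter
      (fun s => ∑ r : Fin d, (s r : ℂ) * zt d ^ (r : ℕ) = 0), ∏ r, phi q (s r) m := by
  have := sum_cls q m d (fun s => if ∑ r : Fin d, (s r : ℂ) * zt d ^ (r : ℕ) = 0 then 1 else 0)
  rw [sum_filter]
  simp only [ite_mul, one_mul, zero_mul] at this
  rw [← this, Pd]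
  refine sum_congr rfl fun c _ => ?_
  rw [evl_cls c _ (zt_prim hd.ne').pow_eq_one]

lemma Pd_le {q : ℝ} (hq0 : 0 < q) (hq1 : q < 1) (m d : ℕ) (hd : 0 < d) :
    Pd q (m * d) d ≤ phiMax q m ^ d.totient := by
  rw [Pd_eq q m d hd]
  set E := (Fintype.piFinset (fun _ : Fin d => range (m + 1))).filter
      (fun s => ∑ r : Fin d, (s r : ℂ) * zt d ^ (r : ℕ) = 0) with hE
  let P : Fin d → Prop := fun r => (r : ℕ) < d.totient
  let res : (Fin d → ℕ) → ({r : Fin d // ¬ P r} → ℕ) := fun s r => s r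
  have hcard : Fintype.card {r : Fin d // P r} = d.totient := by
    rw [Fintype.card_subtype]
    have h : #{i : Fin d | (i : ℕ) < d.totient} = min d d.totient := Fin.card_filter_val_lt
    rw [min_eq_right (Nat.totient_le d)] at h
    exact h
  have hM := phiMax_pos hq0 hq1 m
  have step : ∀ s ∈ E, ∏ r, phi q (s r) m ≤
      phiMax q m ^ d.totient * ∏ r : {r : Fin d // ¬ P r}, phi q (res s r) m := by
    intro s _
    rw [← Fintype.prod_subtype_mul_prod_subtype P]
    apply mul_le_mul_of_nonneg_right
    · calc _ ≤ ∏ r : {r : Fin d // P r}, phiMax q m :=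
          prod_le_prod (fun _ _ => phi_nonneg hq0 hq1 _ _) (fun _ _ => phi_le_phiMax hq0 hq1 _ _)
        _ = _ := by rw [prod_const, card_univ, hcard]
    · exact prod_nonneg fun _ _ => phi_nonneg hq0 hq1 _ _
  refine (sum_le_sum step).trans ?_
  rw [← mul_sum]
  have hinj : Set.InjOn res E := by
    intro s hs t ht hst
    have hs' := (mem_filter.1 hs).2
    have ht' := (mem_filter.1 ht).2
    have := lin_indep hd (fun r => (s r : ℤ) - t r) (by
      push_cast
      simp_rw [sub_mul]
      rw [sum_sub_distrib, hs', ht', sub_zero]) (by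
      intro r hr
      have := congrFun hst ⟨r, by simp only [P]; omega⟩
      simp only [res] at this
      simp [this])
    ext r
    have := this r
    omega
  have h1 : ∑ s ∈ E, ∏ r : {r : Fin d // ¬ P r}, phi q (res s r) m ≤ 1 := by
    rw [← sum_image (f := fun u : {r : Fin d // ¬ P r} → ℕ => ∏ r, phi q (u r) m) hinj]
    calc _ ≤ ∑ u ∈ Fintype.piFinset (fun _ : {r : Fin d // ¬ P r} => range (m + 1)),
          ∏ r, phi q (u r) m := by
          apply sum_le_sum_of_subset_of_nonneg
          · intro u hu
            obtain ⟨s, hs, rfl⟩ := mem_image.1 hu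
            rw [Fintype.mem_piFinset]
            intro r
            exact Fintype.mem_piFinset.1 (mem_filter.1 hs).1 r
          · intros; exact prod_nonneg fun _ _ => phi_nonneg hq0 hq1 _ _
      _ = 1 := by
          rw [← prod_univ_sum (fun _ : {r : Fin d // ¬ P r} => range (m + 1)) (fun _ k => phi q k m)]
          exact prod_eq_one fun _ _ => sum_phi m
  have := pow_pos hM d.totient
  nlinarith

lemma Pd_prime (q : ℝ) (m p : ℕ) (hp : p.Prime) :
    Pd q (m * p) p = ∑ k ∈ range (m + 1), phi q k m ^ p := by
  rw [Pd_eq q m p hp.pos]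
  have hgeom : ∑ r : Fin p, zt p ^ (r : ℕ) = 0 := by
    rw [Fin.sum_univ_eq_sum_range (fun i => zt p ^ i)]
    exact (zt_prim hp.ne_zero).geom_sum_eq_zero hp.one_lt
  have : NeZero p := ⟨hp.ne_zero⟩
  have hE : (Fintype.piFinset (fun _ : Fin p => range (m + 1))).filter
      (fun s => ∑ r : Fin p, (s r : ℂ) * zt p ^ (r : ℕ) = 0) =
      (range (m + 1)).image (fun k (_ : Fin p) => k) := by
    ext s
    simp only [mem_filter, Fintype.mem_piFinset, mem_image]
    constructor
    · rintro ⟨h1, h2⟩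
      have hlast : p - 1 < p := by have := hp.pos; omega
      have := lin_indep hp.pos (fun r => (s r : ℤ) - s ⟨p - 1, hlast⟩) (by
        push_cast
        simp_rw [sub_mul]
        rw [sum_sub_distrib, h2, ← mul_sum, hgeom]; simp) (by
        intro r hr
        rw [Nat.totient_prime hp] at hr
        have : r = ⟨p - 1, hlast⟩ := Fin.ext (by have := r.2; simp only; omega)
        rw [this]; simp)
      refine ⟨s ⟨p - 1, hlast⟩, h1 _, ?_⟩
      ext r
      have := this r
      omega
    · rintro ⟨k, hk, rfl⟩
      refine ⟨fun _ => hk, ?_⟩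
      rw [← mul_sum, hgeom, mul_zero]
  rw [hE, sum_image]
  · simp
  · intro a _ b _ hab
    exact congrFun hab 0

lemma Pq_ge {q : ℝ} (hq0 : 0 < q) (hq1 : q < 1) {n d : ℕ} (hn : 0 < n) (hd : d ∣ n) :
    Pd q n d ≤ Pq q n := by
  have : NeZero n := ⟨hn.ne'⟩
  have hd0 := Nat.pos_of_dvd_of_pos hd hn
  apply sum_le_sum
  intro c _
  have hw := bernWeight_nonneg hq0 hq1 n c
  split_ifs with h1 h2 h2
  · exact le_rfl
  · exfalso
    apply h2
    rw [det_iff c (zt_prim hn.ne')]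
    have hz : zt d ^ n = 1 := by
      obtain ⟨a, rfl⟩ := hd
      rw [pow_mul, (zt_prim hd0.ne').pow_eq_one, one_pow]
    obtain ⟨i, hi, h⟩ := (zt_prim hn.ne').eq_pow_of_pow_eq_one hz
    exact ⟨⟨i, hi⟩, by simpa [h] using h1⟩
  · exact hw
  · exact le_rfl

lemma Pq_le {q : ℝ} (hq0 : 0 < q) (hq1 : q < 1) {n : ℕ} (hn : 1 < n) :
    Pq q n ≤ ∑ d ∈ n.divisors.erase 1, Pd q n d := by
  have hn0 : 0 < n := by omega
  have : NeZero n := ⟨hn0.ne'⟩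
  unfold Pd Pq
  rw [sum_comm]
  apply sum_le_sum
  intro c _
  have hw := bernWeight_nonneg hq0 hq1 n c
  have hnn : ∀ d ∈ n.divisors.erase 1, 0 ≤ (if evl c (zt d) = 0 then bernWeight q n c else 0) := by
    intro d _
    split_ifs <;> simp [hw]
  split_ifs with h
  · rw [det_iff c (zt_prim hn0.ne')] at h
    obtain ⟨k, hk⟩ := h
    have hex : ∃ d ∈ n.divisors.erase 1, evl c (zt d) = 0 := by
      by_cases h1 : orderOf (zt n ^ (k : ℕ)) = 1
      · refine ⟨n, by simp; omega, ?_⟩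
        rw [orderOf_eq_one_iff] at h1
        rw [h1] at hk
        have hc : ∀ j, c j = false := by
          simp only [evl, one_pow, mul_one, sum_boole] at hk
          rw [Nat.cast_eq_zero, card_eq_zero, filter_eq_empty_iff] at hk
          intro j
          simpa using hk (mem_univ j)
        simp [evl, hc]
      · have hpow : (zt n ^ (k : ℕ)) ^ n = 1 := by
          rw [← pow_mul, mul_comm, pow_mul, (zt_prim hn0.ne').pow_eq_one, one_pow]
        have hdvd := orderOf_dvd_of_pow_eq_one hpow
        have hpos := Nat.pos_of_dvd_of_pos hdvd hn0
        refine ⟨orderOf (zt n ^ (k : ℕ)), by simp [h1, hdvd]; omega, ?_⟩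
        exact evl_conj hpos c (IsPrimitiveRoot.orderOf _) (zt_prim hpos.ne') hk
    obtain ⟨d, hd, h0⟩ := hex
    calc bernWeight q n c = if evl c (zt d) = 0 then bernWeight q n c else 0 := by rw [if_pos h0]
      _ ≤ _ := single_le_sum hnn hd
  · exact sum_nonneg hnn

noncomputable def mainS (q : ℝ) (n : ℕ) : ℝ :=
  ∑ k ∈ Finset.range (n / n.minFac + 1), (phi q k (n / n.minFac)) ^ n.minFac

lemma Pd_minFac (q : ℝ) {n : ℕ} (hn : 1 < n) : Pd q n n.minFac = mainS q n := by
  have hp := Nat.minFac_prime (show n ≠ 1 by omega)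
  have := Pd_prime q (n / n.minFac) n.minFac hp
  rwa [Nat.div_mul_cancel (Nat.minFac_dvd n)] at this

lemma mainS_le {q : ℝ} (hq0 : 0 < q) (hq1 : q < 1) {n : ℕ} (hn : 1 < n) :
    mainS q n ≤ Pq q n := by
  rw [← Pd_minFac q hn]
  exact Pq_ge hq0 hq1 (by omega) (Nat.minFac_dvd n)

lemma Pq_le_main {q : ℝ} (hq0 : 0 < q) (hq1 : q < 1) {n : ℕ} (hn : 1 < n) :
    Pq q n ≤ mainS q n +
      ∑ d ∈ (n.divisors.erase 1).erase n.minFac, phiMax q (n / d) ^ d.totient := by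
  refine (Pq_le hq0 hq1 hn).trans ?_
  have hp := Nat.minFac_prime (show n ≠ 1 by omega)
  have hmem : n.minFac ∈ n.divisors.erase 1 := by
    simp [hp.ne_one, Nat.minFac_dvd]; omega
  rw [← add_sum_erase _ _ hmem, Pd_minFac q hn]
  gcongr with d hd
  have hdn : d ∣ n := Nat.dvd_of_mem_divisors (mem_of_mem_erase (mem_of_mem_erase hd))
  have := Pd_le hq0 hq1 (n / d) d (Nat.pos_of_dvd_of_pos hdn (by omega))
  rwa [Nat.div_mul_cancel hdn] at this

end comb

section nt

lemma totient_sq (n : ℕ) : n ≤ 2 * n.totient ^ 2 ∧ (Odd n → n ≤ n.totient ^ 2) := by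
  induction n using Nat.recOnPosPrimePosCoprime with
  | zero => simp
  | one => simp
  | prime_pow p k hp hk =>
    obtain ⟨k, rfl⟩ : ∃ j, k = j + 1 := ⟨k - 1, by omega⟩
    rw [Nat.totient_prime_pow_succ hp]
    obtain ⟨u, rfl⟩ : ∃ u, p = u + 2 := ⟨p - 2, by have := hp.two_le; omega⟩
    have hx : 1 ≤ (u + 2) ^ k := Nat.one_le_pow _ _ (by omega)
    set x := (u + 2) ^ k with hxd
    rw [pow_succ, ← hxd, show u + 2 - 1 = u + 1 by omega]
    constructor
    · have : x * (u + 2) ≤ x * (x * (2 * (u + 1) ^ 2)) := by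
        apply Nat.mul_le_mul_left; nlinarith
      nlinarith
    · intro hodd
      have hu : 1 ≤ u := by
        rcases Nat.eq_zero_or_pos u with h | h
        · subst h
          exact absurd (Nat.odd_mul.1 hodd).2 (by decide)
        · exact h
      have : x * (u + 2) ≤ x * (x * ((u + 1) ^ 2)) := by
        apply Nat.mul_le_mul_left; nlinarith
      nlinarith
  | coprime a b ha hb hab iha ihb =>
    rw [Nat.totient_mul hab, mul_pow]
    constructor
    · rcases Nat.even_or_odd a with h | h
      · have hbo : Odd b := by
          rcases Nat.even_or_odd b with h' | h'
          · have := Nat.dvd_gcd h.two_dvd h'.two_dvd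
            rw [hab] at this; omega
          · exact h'
        calc a * b ≤ (2 * a.totient ^ 2) * b.totient ^ 2 := Nat.mul_le_mul iha.1 (ihb.2 hbo)
          _ = _ := by ring
      · calc a * b ≤ a.totient ^ 2 * (2 * b.totient ^ 2) := Nat.mul_le_mul (iha.2 h) ihb.1
          _ = _ := by ring
    · intro ho
      obtain ⟨h1, h2⟩ := Nat.odd_mul.1 ho
      exact Nat.mul_le_mul (iha.2 h1) (ihb.2 h2)

lemma comp_bound {d : ℕ} (hd : 1 < d) (hnp : ¬ d.Prime) :
    ∃ t : ℕ, d = d.minFac * t ∧ d.minFac ≤ t ∧ (d.minFac - 1) * t.totient ≤ d.totient ∧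
      (d.minFac : ℝ) * √t ≤ 4 * d.totient := by
  have hl := Nat.minFac_prime (show d ≠ 1 by omega)
  obtain ⟨t, ht⟩ := Nat.minFac_dvd d
  have hsq := Nat.minFac_sq_le_self (by omega : 0 < d) hnp
  set l := d.minFac with hld
  have hlt : l ≤ t := by
    rw [ht, sq] at hsq
    exact Nat.le_of_mul_le_mul_left hsq hl.pos
  have hphi : (l - 1) * t.totient ≤ d.totient := by
    have := Nat.totient_super_multiplicative l t
    rw [← ht, Nat.totient_prime hl] at this
    exact this
  refine ⟨t, ht, hlt, hphi, ?_⟩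
  have h1 : (t : ℝ) ≤ 2 * (t.totient : ℝ) ^ 2 := by exact_mod_cast (totient_sq t).1
  have h2 : √(t : ℝ) ≤ 2 * t.totient := by
    rw [Real.sqrt_le_left (by positivity)]
    nlinarith [sq_nonneg (t.totient : ℝ)]
  have h3 : (l : ℝ) ≤ 2 * ((l - 1 : ℕ) : ℝ) := by
    have := hl.two_le
    exact_mod_cast (by omega : l ≤ 2 * (l - 1))
  have h4 : (((l - 1 : ℕ) : ℝ)) * t.totient ≤ d.totient := by exact_mod_cast hphi
  calc (l : ℝ) * √t ≤ (2 * ((l - 1 : ℕ) : ℝ)) * (2 * t.totient) := by gcongr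
    _ = 4 * (((l - 1 : ℕ) : ℝ) * t.totient) := by ring
    _ ≤ _ := by linarith

lemma log_le_two_sqrt {x : ℝ} (hx : 0 < x) : Real.log x ≤ 2 * √x := by
  have h1 := Real.log_le_sub_one_of_pos (Real.sqrt_pos.2 hx)
  rw [Real.log_sqrt hx.le] at h1
  linarith

lemma claimB {p d g : ℕ} (hp : 2 ≤ p) (hpd : p < d) (hmin : p ≤ d.minFac)
    (hg1 : d.Prime → d ≤ p + 2 * g) (hg2 : ¬ d.Prime → d.totient ≤ 4 * g) :
    ((d : ℝ) / p) ^ p * ((d : ℝ) - p) ^ 2 ≤ Real.exp 128 ^ g := by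
  have hp0 : (0 : ℝ) < p := by exact_mod_cast (by omega : 0 < p)
  have hpd' : (p : ℝ) < d := by exact_mod_cast hpd
  rw [← Real.exp_nat_mul]
  by_cases hd : d.Prime
  · have h1 : ((d : ℝ) / p) ^ p ≤ Real.exp (d - p) := by
      have : (d : ℝ) / p ≤ Real.exp ((d - p) / p) := by
        have := Real.add_one_le_exp (((d : ℝ) - p) / p)
        have e : (d : ℝ) / p = (d - p) / p + 1 := by field_simp; ring
        rw [e]; exact this
      calc _ ≤ Real.exp ((d - p) / p) ^ p := by gcongr
        _ = _ := by rw [← Real.exp_nat_mul]; congr 1; field_simp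
    have h2 : ((d : ℝ) - p) ^ 2 ≤ Real.exp (d - p) ^ 2 := by
      have := Real.add_one_le_exp ((d : ℝ) - p)
      have h0 : 0 ≤ (d : ℝ) - p := by linarith
      gcongr; linarith
    have h3 : (d : ℝ) ≤ p + 2 * g := by exact_mod_cast hg1 hd
    calc _ ≤ Real.exp (d - p) * Real.exp (d - p) ^ 2 := by gcongr
      _ = Real.exp (3 * (d - p)) := by rw [← Real.exp_nat_mul, ← Real.exp_add]; push_cast; ring_nf
      _ ≤ _ := by
        apply Real.exp_le_exp.2
        have : (0 : ℝ) ≤ g := by positivity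
        nlinarith
  · obtain ⟨t, ht, hlt, -, hb⟩ := comp_bound (by omega) hd
    have hd0 : (0 : ℝ) < d := by linarith
    have hd1 : (1 : ℝ) ≤ d := by exact_mod_cast (by omega : 1 ≤ d)
    have ht0 : 0 < t := by omega
    have ht0' : (0 : ℝ) < t := by exact_mod_cast ht0
    have hdt : (d : ℝ) ≤ (t : ℝ) ^ 2 := by
      have : d ≤ t ^ 2 := by
        calc d = d.minFac * t := ht
          _ ≤ t * t := Nat.mul_le_mul_right _ hlt
          _ = _ := by ring
      exact_mod_cast this
    have hlog : Real.log d ≤ 4 * √t := by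
      have := Real.log_le_log hd0 hdt
      rw [Real.log_pow] at this
      have := log_le_two_sqrt ht0'
      push_cast at *
      linarith
    have hlog0 := Real.log_nonneg hd1
    have hmin' : (p : ℝ) ≤ d.minFac := by exact_mod_cast hmin
    have hg : (d.totient : ℝ) ≤ 4 * g := by exact_mod_cast hg2 hd
    have hpl : (p : ℝ) * Real.log d ≤ 64 * g := by
      calc (p : ℝ) * Real.log d ≤ d.minFac * (4 * √t) := by gcongr
        _ = 4 * (d.minFac * √t) := by ring
        _ ≤ 4 * (4 * (4 * g)) := by linarith
        _ = _ := by ring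
    calc ((d : ℝ) / p) ^ p * ((d : ℝ) - p) ^ 2 ≤ (d : ℝ) ^ p * (d : ℝ) ^ p := by
          gcongr
          · apply div_le_self hd0.le; exact_mod_cast (by omega : 1 ≤ p)
          · calc ((d : ℝ) - p) ^ 2 ≤ (d : ℝ) ^ 2 := by
                  apply pow_le_pow_left₀ <;> linarith
              _ ≤ (d : ℝ) ^ p := pow_le_pow_right₀ hd1 hp
      _ = Real.exp (2 * (p * Real.log d)) := by
          rw [two_mul, Real.exp_add, Real.exp_nat_mul, Real.exp_log hd0]
      _ ≤ _ := by apply Real.exp_le_exp.2; linarith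

lemma log_small {c : ℝ} (hc : 0 < c) : ∃ N : ℕ, ∀ n : ℕ, N ≤ n → Real.log n ≤ c * √n := by
  have h := (isLittleO_log_rpow_atTop (show (0 : ℝ) < 1 / 2 by norm_num)).bound hc
  have h2 := tendsto_natCast_atTop_atTop.eventually h
  obtain ⟨N, hN⟩ := Filter.eventually_atTop.1 h2
  refine ⟨N, fun n hn => ?_⟩
  have := hN n hn
  rw [← Real.sqrt_eq_rpow, Real.norm_eq_abs, Real.norm_eq_abs, abs_of_nonneg (Real.sqrt_nonneg _)] at this
  exact (le_abs_self _).trans this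

lemma lemQ {A : ℝ} (hA : 0 < A) (T : ℕ) : ∃ N : ℕ, ∀ n d : ℕ, N ≤ n → 1 < n → ¬ n.Prime → d ∣ n →
    n / d < T → A * (n.minFac * Real.log n) ≤ d.totient := by
  obtain ⟨N1, hN1⟩ := log_small (show 0 < 1 / (8 * A) by positivity)
  obtain ⟨N2, hN2⟩ := log_small (show 0 < 1 / (A * (T + 1) * (2 * (T + 1))) by positivity)
  refine ⟨N1 ^ 2 + N2, fun n d hn h1 hnp hd hT => ?_⟩
  have hn0 : (0 : ℝ) < n := by exact_mod_cast (by omega : 0 < n)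
  by_cases hdn : d = n
  · subst hdn
    obtain ⟨t, ht, hlt, -, hb⟩ := comp_bound h1 hnp
    have hdt2 : d ≤ t ^ 2 := by
      calc d = d.minFac * t := ht
        _ ≤ t * t := Nat.mul_le_mul_right _ hlt
        _ = _ := by ring
    have hdt : (d : ℝ) ≤ (t : ℝ) ^ 2 := by exact_mod_cast hdt2
    have htN : N1 ≤ t := by
      by_contra hc
      push Not at hc
      have : t ^ 2 < N1 ^ 2 := Nat.pow_lt_pow_left hc (by norm_num)
      omega
    have hl := hN1 t htN
    have hlog := Real.log_le_log hn0 hdt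
    rw [Real.log_pow] at hlog
    push_cast at hlog
    have : A * Real.log d ≤ √t / 4 := by
      calc A * Real.log d ≤ A * (2 * (1 / (8 * A) * √t)) := by gcongr; linarith
        _ = _ := by field_simp; ring
    calc A * (d.minFac * Real.log d) = d.minFac * (A * Real.log d) := by ring
      _ ≤ d.minFac * (√t / 4) := by gcongr
      _ ≤ _ := by linarith
  · obtain ⟨a, rfl⟩ := hd
    have hd0 : 0 < d := Nat.pos_of_ne_zero (by rintro rfl; simp at h1)
    rw [Nat.mul_div_cancel_left _ hd0] at hT
    have ha : 2 ≤ a := by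
      rcases a with _ | _ | a
      · simp at h1
      · simp at hdn
      · omega
    have hmf : (d * a).minFac ≤ a := Nat.minFac_le_of_dvd ha (Dvd.intro_left d rfl)
    have hl := hN2 (d * a) (by omega)
    have hmf' : ((d * a).minFac : ℝ) ≤ T + 1 := by exact_mod_cast (by omega : (d * a).minFac ≤ T + 1)
    have haT : (a : ℝ) ≤ T + 1 := by exact_mod_cast (by omega : a ≤ T + 1)
    have hT0 : (0 : ℝ) < (T : ℝ) + 1 := by positivity
    have hs : √((d * a : ℕ) : ℝ) ≤ 2 * (T + 1) * d.totient := by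
      rw [Real.sqrt_le_left (by positivity)]
      have h2 : (d : ℝ) ≤ 2 * (d.totient : ℝ) ^ 2 := by exact_mod_cast (totient_sq d).1
      push_cast
      calc (d : ℝ) * a ≤ (2 * (d.totient : ℝ) ^ 2) * (T + 1) := by gcongr
        _ ≤ (2 * (d.totient : ℝ) ^ 2) * (2 * (T + 1) ^ 2) := by
            gcongr
            have : (0 : ℝ) ≤ T := by positivity
            nlinarith
        _ = _ := by ring
    have hl0 : 0 ≤ Real.log ((d * a : ℕ) : ℝ) := Real.log_nonneg (by exact_mod_cast h1.le)
    calc A * ((d * a).minFac * Real.log ((d * a : ℕ) : ℝ))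
        ≤ A * ((T + 1) * (1 / (A * (T + 1) * (2 * (T + 1))) * (2 * (T + 1) * d.totient))) := by
          gcongr
          exact hl.trans (by gcongr)
      _ = _ := by field_simp

end nt

section assembly
variable {q : ℝ}

lemma mainS_ge (hq0 : 0 < q) (hq1 : q < 1) (n : ℕ) :
    phiMax q (n / n.minFac) ^ n.minFac ≤ mainS q n := by
  obtain ⟨k, hk, h⟩ := phiMax_exists q (n / n.minFac)
  rw [← h]
  exact single_le_sum (f := fun k => (phi q k (n / n.minFac)) ^ n.minFac)
    (fun i _ => pow_nonneg (phi_nonneg hq0 hq1 _ _) _) (mem_range.2 (by omega))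

lemma mainS_pos (hq0 : 0 < q) (hq1 : q < 1) (n : ℕ) : 0 < mainS q n :=
  lt_of_lt_of_le (pow_pos (phiMax_pos hq0 hq1 _) _) (mainS_ge hq0 hq1 n)

lemma mainS_ge_inv (hq0 : 0 < q) (hq1 : q < 1) {n : ℕ} (hn : 1 < n) :
    1 ≤ (n : ℝ) ^ n.minFac * mainS q n := by
  have hp := Nat.minFac_prime (show n ≠ 1 by omega)
  have h1 : n / n.minFac + 1 ≤ n := by
    have : n / n.minFac < n := Nat.div_lt_self (by omega) hp.one_lt
    omega
  have h2 := phiMax_ge hq0 hq1 (n / n.minFac)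
  have h1' : ((n / n.minFac : ℕ) : ℝ) + 1 ≤ n := by exact_mod_cast h1
  have h3 : 1 ≤ (n : ℝ) * phiMax q (n / n.minFac) := by
    rw [div_le_iff₀ (by positivity)] at h2
    have := phiMax_pos hq0 hq1 (n / n.minFac)
    nlinarith
  calc (1 : ℝ) ≤ ((n : ℝ) * phiMax q (n / n.minFac)) ^ n.minFac := one_le_pow₀ h3
    _ = (n : ℝ) ^ n.minFac * phiMax q (n / n.minFac) ^ n.minFac := mul_pow _ _ _
    _ ≤ _ := by gcongr; exact mainS_ge hq0 hq1 n

/-- the far divisors: `n / d` small -/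
lemma far_terms (hq0 : 0 < q) (hq1 : q < 1) {ε : ℝ} (hε : 0 < ε) (T : ℕ) :
    ∃ N : ℕ, ∀ n d : ℕ, N ≤ n → 1 < n → ¬ n.Prime → d ∣ n → n.minFac ≤ d → n / d < T →
      phiMax q (n / d) ^ d.totient * ((d : ℝ) - n.minFac) ^ 2 ≤ ε * mainS q n := by
  set r := max q (1 - q) with hr
  have hr0 : 0 < r := lt_of_lt_of_le hq0 (le_max_left _ _)
  have hr1 : r < 1 := max_lt hq1 (by linarith)
  have hlr : 0 < - Real.log r := by
    have := Real.log_neg hr0 hr1; linarith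
  obtain ⟨N, hN⟩ := lemQ (show 0 < 3 / (- Real.log r) by positivity) T
  obtain ⟨N', hN'⟩ := exists_nat_ge (1 / ε)
  refine ⟨N + N', fun n d hn h1 hnp hd hpd hT => ?_⟩
  have hQ := hN n d (by omega) h1 hnp hd hT
  have hp := Nat.minFac_prime (show n ≠ 1 by omega)
  have hn0 : (0 : ℝ) < n := by exact_mod_cast (by omega : 0 < n)
  have hn1 : (1 : ℝ) ≤ n := by exact_mod_cast h1.le
  have hdn : d ≤ n := Nat.le_of_dvd (by omega) hd
  have hS := mainS_ge_inv hq0 hq1 h1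
  have hS0 := mainS_pos hq0 hq1 n
  set p := n.minFac with hpdef
  have e1 : phiMax q (n / d) ^ d.totient ≤ r ^ d.totient := by
    apply pow_le_pow_left₀ (phiMax_pos hq0 hq1 _).le
    apply phiMax_le_one hq0 hq1
    exact Nat.div_pos hdn (Nat.pos_of_dvd_of_pos hd (by omega))
  have e2 : r ^ d.totient * (n : ℝ) ^ (3 * p) ≤ 1 := by
    have a1 : r ^ d.totient = Real.exp (d.totient * Real.log r) := by
      rw [Real.exp_nat_mul, Real.exp_log hr0]
    have a2 : (n : ℝ) ^ (3 * p) = Real.exp (((3 * p : ℕ) : ℝ) * Real.log n) := by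
      rw [Real.exp_nat_mul, Real.exp_log hn0]
    rw [a1, a2, ← Real.exp_add, Real.exp_le_one_iff]
    rw [div_mul_eq_mul_div, div_le_iff₀ hlr] at hQ
    push_cast
    linarith
  have e3 : ((d : ℝ) - p) ^ 2 ≤ (n : ℝ) ^ p := by
    have b1 : (p : ℝ) ≤ d := by exact_mod_cast hpd
    have b2 : (d : ℝ) ≤ n := by exact_mod_cast hdn
    have b3 : (0 : ℝ) ≤ p := by positivity
    calc ((d : ℝ) - p) ^ 2 ≤ (n : ℝ) ^ 2 := by apply pow_le_pow_left₀ <;> linarith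
      _ ≤ _ := pow_le_pow_right₀ hn1 hp.two_le
  have e4 : 1 ≤ ε * (n : ℝ) ^ p := by
    have c1 : 1 / ε ≤ n := hN'.trans (by exact_mod_cast (by omega : N' ≤ n))
    have c2 : (n : ℝ) ≤ (n : ℝ) ^ p := le_self_pow₀ hn1 hp.ne_zero
    rw [div_le_iff₀ hε] at c1
    nlinarith
  set x := (n : ℝ) ^ p with hx
  have hx0 : 0 < x := by positivity
  have hx3 : (n : ℝ) ^ (3 * p) = x ^ 3 := by rw [hx, ← pow_mul, mul_comm]
  rw [hx3] at e2
  set y := r ^ d.totient with hy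
  have hy0 : 0 < y := by positivity
  calc _ ≤ y * x := by gcongr
    _ ≤ y * x * (ε * x) * (x * mainS q n) := by
        have : 0 < y * x := by positivity
        have h' : 1 ≤ (ε * x) * (x * mainS q n) := one_le_mul_of_one_le_of_one_le e4 hS
        nlinarith
    _ = (y * x ^ 3) * (ε * mainS q n) := by ring
    _ ≤ 1 * (ε * mainS q n) := by gcongr
    _ = _ := one_mul _

lemma near_terms (hq0 : 0 < q) (hq1 : q < 1) {ε : ℝ} (hε : 0 < ε) :
    ∃ T N : ℕ, ∀ n d : ℕ, N ≤ n → 1 < n → d ∣ n → d ≠ 1 → d ≠ n.minFac → T ≤ n / d →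
      phiMax q (n / d) ^ d.totient * ((d : ℝ) - n.minFac) ^ 2 ≤ ε * mainS q n := by
  set B := Real.exp 128 with hB
  have hB0 : 0 < B := Real.exp_pos _
  set δ := min 1 ε / B with hδ
  have hδ0 : 0 < δ := by positivity
  have hδ1 : δ * B ≤ 1 := by rw [hδ, div_mul_cancel₀ _ hB0.ne']; exact min_le_left _ _
  have hδ2 : δ * B ≤ ε := by rw [hδ, div_mul_cancel₀ _ hB0.ne']; exact min_le_right _ _
  obtain ⟨T, hT⟩ := phiMax_small hq0 hq1 hδ0
  obtain ⟨K, hK⟩ := exists_nat_gt (B / ε)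
  have hK0' : (0 : ℝ) < K := lt_trans (by positivity) hK
  have hK0 : 0 < K := by exact_mod_cast hK0'
  obtain ⟨T2, hT2⟩ := sum_sq_ge hq0 hq1 K hK0
  refine ⟨T, 2 * T2, fun n d hn h1 hd hd1 hdp hTd => ?_⟩
  have hp := Nat.minFac_prime (show n ≠ 1 by omega)
  have hd0 : 0 < d := Nat.pos_of_dvd_of_pos hd (by omega)
  have hmin : n.minFac ≤ d.minFac :=
    Nat.minFac_le_of_dvd (Nat.minFac_prime hd1).two_le ((Nat.minFac_dvd d).trans hd)
  have hdm : d.minFac ≤ d := Nat.minFac_le hd0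
  have hpd : n.minFac < d := by omega
  have hMd := hT _ hTd
  have hMd0 := phiMax_pos hq0 hq1 (n / d)
  have hcomp := phiMax_comp hq0 hq1 (by omega) hd (Nat.minFac_dvd n) hpd.le
  have hSge := mainS_ge hq0 hq1 n
  have hM0 := phiMax_pos hq0 hq1 (n / n.minFac)
  have hp2 := hp.two_le
  -- general bound
  have gen : n.minFac ≤ d.totient →
      phiMax q (n / d) ^ d.totient * ((d : ℝ) - n.minFac) ^ 2 ≤
      phiMax q (n / n.minFac) ^ n.minFac * (δ ^ (d.totient - n.minFac) *
        (((d : ℝ) / n.minFac) ^ n.minFac * ((d : ℝ) - n.minFac) ^ 2)) := by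
    intro hle
    have : phiMax q (n / d) ^ d.totient =
        phiMax q (n / d) ^ n.minFac * phiMax q (n / d) ^ (d.totient - n.minFac) := by
      rw [← pow_add]; congr 1; omega
    rw [this]
    calc _ ≤ ((d : ℝ) / n.minFac * phiMax q (n / n.minFac)) ^ n.minFac *
          δ ^ (d.totient - n.minFac) * ((d : ℝ) - n.minFac) ^ 2 := by gcongr
      _ = _ := by rw [mul_pow]; ring
  by_cases h2 : n.minFac = 2
  · have ht2 : 2 ≤ d.totient := by
      have hpos := Nat.totient_pos.2 hd0
      by_contra hc
      have : d.totient = 1 := by omega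
      rw [Nat.totient_eq_one_iff] at this
      omega
    have hb := claimB (g := d.totient - 1) hp2 hpd hmin (by
      intro hdp'; rw [Nat.totient_prime hdp']; omega) (by intro _; omega)
    have hg := gen (by omega)
    rw [h2] at hg hb ⊢
    have hS2 : (K : ℝ) * phiMax q (n / 2) ^ 2 ≤ mainS q n := by
      have := hT2 (n / 2) (by omega)
      unfold mainS; rw [h2]; exact this
    rw [h2] at hM0
    have : δ ^ (d.totient - 2) * B ^ (d.totient - 1) ≤ B := by
      rw [show d.totient - 1 = (d.totient - 2) + 1 by omega, pow_succ, ← mul_assoc, ← mul_pow]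
      have : (δ * B) ^ (d.totient - 2) ≤ 1 := pow_le_one₀ (by positivity) hδ1
      nlinarith
    calc _ ≤ _ := hg
      _ ≤ phiMax q (n / 2) ^ 2 * (δ ^ (d.totient - 2) * B ^ (d.totient - 1)) := by gcongr
      _ ≤ phiMax q (n / 2) ^ 2 * B := by gcongr
      _ ≤ phiMax q (n / 2) ^ 2 * (ε * K) := by
          gcongr
          rw [div_lt_iff₀ hε] at hK; linarith
      _ = ε * (K * phiMax q (n / 2) ^ 2) := by ring
      _ ≤ _ := by gcongr
  · have hp3 : 3 ≤ n.minFac := by omega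
    have hodd : Odd n.minFac := hp.odd_of_ne_two h2
    have hgs : n.minFac + 1 ≤ d.totient ∧ (d.Prime → d ≤ n.minFac + 2 * (d.totient - n.minFac)) ∧
        (¬ d.Prime → d.totient ≤ 4 * (d.totient - n.minFac)) := by
      by_cases hdpr : d.Prime
      · have hdo : Odd d := hdpr.odd_of_ne_two (by omega)
        rw [Nat.totient_prime hdpr]
        obtain ⟨a, ha⟩ := hodd
        obtain ⟨b, hb⟩ := hdo
        refine ⟨by omega, fun _ => by omega, fun h => absurd hdpr h⟩
      · obtain ⟨t, ht, hlt, hphi, -⟩ := comp_bound (by omega) hdpr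
        have ht2 : 2 ≤ t.totient := by
          have hpos := Nat.totient_pos.2 (show 0 < t by omega)
          by_contra hc
          have : t.totient = 1 := by omega
          rw [Nat.totient_eq_one_iff] at this
          omega
        have : (d.minFac - 1) * 2 ≤ d.totient := le_trans (Nat.mul_le_mul_left _ ht2) hphi
        refine ⟨by omega, fun h => absurd h hdpr, fun _ => by omega⟩
    obtain ⟨g1, g2, g3⟩ := hgs
    have hb := claimB hp2 hpd hmin g2 g3
    have hg := gen (by omega)
    have : δ ^ (d.totient - n.minFac) * B ^ (d.totient - n.minFac) ≤ ε := by
      rw [← mul_pow]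
      refine le_trans ?_ hδ2
      exact pow_le_of_le_one (by positivity) hδ1 (by omega)
    calc _ ≤ _ := hg
      _ ≤ phiMax q (n / n.minFac) ^ n.minFac *
          (δ ^ (d.totient - n.minFac) * B ^ (d.totient - n.minFac)) := by gcongr
      _ ≤ phiMax q (n / n.minFac) ^ n.minFac * ε := by gcongr
      _ ≤ mainS q n * ε := by gcongr
      _ = _ := mul_comm _ _

lemma error_small (hq0 : 0 < q) (hq1 : q < 1) {ε : ℝ} (hε : 0 < ε) :
    ∃ N : ℕ, ∀ n : ℕ, N ≤ n →
      ∑ d ∈ (n.divisors.erase 1).erase n.minFac, phiMax q (n / d) ^ d.totient ≤ ε * mainS q n := by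
  have hsum : Summable (fun k : ℕ => 1 / (k : ℝ) ^ 2) :=
    Real.summable_one_div_nat_pow.2 (by norm_num)
  set C := ∑' k : ℕ, 1 / (k : ℝ) ^ 2 with hC
  have hC0 : 0 ≤ C := tsum_nonneg fun k => by positivity
  set η := ε / (C + 1) with hη
  have hη0 : 0 < η := by positivity
  obtain ⟨T, N1, h1⟩ := near_terms hq0 hq1 hη0
  obtain ⟨N2, h2⟩ := far_terms hq0 hq1 hη0 T
  refine ⟨N1 + N2 + 2, fun n hn => ?_⟩
  have hS0 := mainS_pos hq0 hq1 n
  have hn1 : 1 < n := by omega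
  have hp := Nat.minFac_prime (show n ≠ 1 by omega)
  have hF : ∀ d ∈ (n.divisors.erase 1).erase n.minFac, d ∣ n ∧ d ≠ 1 ∧ d ≠ n.minFac ∧ n.minFac < d := by
    intro d hd
    simp only [mem_erase, Nat.mem_divisors] at hd
    obtain ⟨a, b, c, -⟩ := hd
    have hd0 : 0 < d := Nat.pos_of_dvd_of_pos c (by omega)
    have : n.minFac ≤ d := Nat.minFac_le_of_dvd (by omega) c
    exact ⟨c, b, a, by omega⟩
  have term : ∀ d ∈ (n.divisors.erase 1).erase n.minFac,
      phiMax q (n / d) ^ d.totient ≤ η * mainS q n * (1 / (((d - n.minFac : ℕ) : ℝ)) ^ 2) := by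
    intro d hd
    obtain ⟨a, b, c, e⟩ := hF d hd
    have hnp : ¬ n.Prime := by
      intro hnp
      rcases (Nat.dvd_prime hnp).1 a with h | h
      · exact b h
      · exact c (by rw [h, hnp.minFac_eq])
    have hpos : (0 : ℝ) < ((d - n.minFac : ℕ) : ℝ) := by exact_mod_cast (by omega : 0 < d - n.minFac)
    rw [mul_one_div, le_div_iff₀ (by positivity), Nat.cast_sub e.le]
    by_cases hT : T ≤ n / d
    · exact h1 n d (by omega) hn1 a b c hT
    · exact h2 n d (by omega) hn1 hnp a e.le (by omega)
  refine (sum_le_sum term).trans ?_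
  rw [← mul_sum]
  have hle : ∑ d ∈ (n.divisors.erase 1).erase n.minFac, 1 / (((d - n.minFac : ℕ) : ℝ)) ^ 2 ≤ C := by
    rw [← sum_image (f := fun k : ℕ => 1 / (k : ℝ) ^ 2) (g := fun d => d - n.minFac)]
    · exact hsum.sum_le_tsum _ (fun k _ => by positivity)
    · intro a ha b hb hab
      have := (hF a ha).2.2.2
      have := (hF b hb).2.2.2
      simp only at hab
      omega
  calc _ ≤ η * mainS q n * C := by gcongr
    _ ≤ η * mainS q n * (C + 1) := by gcongr; linarith
    _ = _ := by rw [hη]; field_simp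

end assembly

/-- Theorem 1 (main theorem): for fixed q ∈ (0,1),
P_q(n) ∼ ∑_{k=0}^{n/p(n)} φ_q(k, n/p(n))^{p(n)} as n → ∞,
where p(n) = n.minFac is the smallest prime divisor of n. -/
theorem Pq_asymptotic (q : ℝ) (hq0 : 0 < q) (hq1 : q < 1) :
    Filter.Tendsto
      (fun n : ℕ =>
        Pq q n /
          ∑ k ∈ Finset.range (n / n.minFac + 1), (phi q k (n / n.minFac)) ^ n.minFac)
      Filter.atTop (nhds 1) := by
  change Filter.Tendsto (fun n : ℕ => Pq q n / mainS q n) Filter.atTop (nhds 1)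
  rw [Metric.tendsto_atTop]
  intro ε hε
  obtain ⟨N, hN⟩ := error_small hq0 hq1 (half_pos hε)
  refine ⟨N + 2, fun n hn => ?_⟩
  have hS0 := mainS_pos hq0 hq1 n
  have h1 := mainS_le hq0 hq1 (show 1 < n by omega)
  have h2 := Pq_le_main hq0 hq1 (show 1 < n by omega)
  have h3 := hN n (by omega)
  have a1 : 1 ≤ Pq q n / mainS q n := by rwa [one_le_div hS0]
  have a2 : Pq q n / mainS q n ≤ 1 + ε / 2 := by
    rw [div_le_iff₀ hS0]; linarith
  rw [Real.dist_eq, abs_lt]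
  constructor <;> linarith
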